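/- arXiv:1911.01510 — 2 statements merged into one kernel-verified Lean document; each statement's English description precedes it below -/
import Mathlib

section
/- Let A be a real N_x×N_x matrix and B a real N_x×N_u matrix, regarded over the field ℝ(z) of rational functions. Suppose matrices Φ_x (N_x×N_x) and Φ_u (N_u×N_x) over ℝ(z) satisfy the SLS achievability constraint (zI − A)·Φ_x − B·Φ_u = I, and suppose Φ_x is invertible. Then I + B·Φ_u is invertible, and the controller transfer matrix K := Φ_u · Φ_x⁻¹ satisfies K = Φ_u · (I + B·Φ_u)⁻¹ · (zI − A). -/
set_option synthInstance.maxHeartbeats 1000000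
set_option maxHeartbeats 1000000

/-- The matrix `z I - A` over the field `ℝ(z)`, with the real matrix `A`
embedded via the constant embedding. -/
noncomputable def zIsubA {Nx : ℕ} (A : Matrix (Fin Nx) (Fin Nx) ℝ) :
    Matrix (Fin Nx) (Fin Nx) (RatFunc ℝ) :=
  Matrix.scalar (Fin Nx) (RatFunc.X : RatFunc ℝ) - A.map (algebraMap ℝ (RatFunc ℝ))

/-- `z I - A` is the image of the characteristic matrix of `A` in `ℝ(z)`. -/
theorem zIsubA_eq_map_charmatrix {Nx : ℕ} (A : Matrix (Fin Nx) (Fin Nx) ℝ) :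
    zIsubA A = A.charmatrix.map (algebraMap (Polynomial ℝ) (RatFunc ℝ)) := by
  ext i j
  by_cases h : i = j
  · subst h
    simp [zIsubA, Matrix.charmatrix_apply_eq, RatFunc.algebraMap_eq_C]
  · simp [zIsubA, RatFunc.algebraMap_eq_C, h]

theorem isUnit_zIsubA {Nx : ℕ} (A : Matrix (Fin Nx) (Fin Nx) ℝ) : IsUnit (zIsubA A) := by
  rw [Matrix.isUnit_iff_isUnit_det, isUnit_iff_ne_zero, zIsubA_eq_map_charmatrix,
    ← RingHom.mapMatrix_apply, ← RingHom.map_det]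
  exact RatFunc.algebraMap_ne_zero A.charpoly_monic.ne_zero

/-- if `(Φx, Φu)` satisfies the SLS achievability constraint
`(zI - A) Φx - B Φu = I` and `Φx` is invertible, then `I + B Φu` is invertible and
the controller `K = Φu Φx⁻¹` satisfies `K = Φu (I + B Φu)⁻¹ (zI - A)`. -/
theorem sls_controller_formula (Nx Nu : ℕ)
    (A : Matrix (Fin Nx) (Fin Nx) ℝ) (B : Matrix (Fin Nx) (Fin Nu) ℝ)
    (Φx : Matrix (Fin Nx) (Fin Nx) (RatFunc ℝ))
    (Φu : Matrix (Fin Nu) (Fin Nx) (RatFunc ℝ))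
    (hconstraint : zIsubA A * Φx - B.map (algebraMap ℝ (RatFunc ℝ)) * Φu = 1)
    (hΦx : IsUnit Φx) :
    IsUnit (1 + B.map (algebraMap ℝ (RatFunc ℝ)) * Φu) ∧
    Φu * Φx⁻¹ =
      Φu * (1 + B.map (algebraMap ℝ (RatFunc ℝ)) * Φu)⁻¹ * zIsubA A := by
  have h : 1 + B.map (algebraMap ℝ (RatFunc ℝ)) * Φu = zIsubA A * Φx :=
    (sub_eq_iff_eq_add.mp hconstraint).symm
  have hA := isUnit_zIsubA A
  rw [h]
  refine ⟨hA.mul hΦx, ?_⟩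
  rw [Matrix.mul_inv_rev, Matrix.mul_assoc, Matrix.mul_assoc,
    Matrix.nonsing_inv_mul _ ((Matrix.isUnit_iff_isUnit_det _).mp hA), Matrix.mul_one]
end

section
/- (Internal stability of the simplified SLS controller, time-domain form.) Let A be a real N_x×N_x Schur stable matrix (every complex eigenvalue has modulus < 1), B a real N_x×N_u matrix, and (Φ_u[τ])_{τ≥1} a family of real N_u×N_x matrices with Σ_{τ≥1} ‖Φ_u[τ]‖ < ∞. Suppose the injected signals d_x : ℤ → ℝ^{N_x}, d_u : ℤ → ℝ^{N_u}, d_δ : ℤ → ℝ^{N_x} are bounded, and the signals x : ℤ → ℝ^{N_x}, u : ℤ → ℝ^{N_u}, δ : ℤ → ℝ^{N_x} satisfy, for all t ∈ ℤ: x[t+1] = A·x[t] + B·u[t] + d_x[t]; u[t] = Σ_{τ≥1} Φ_u[τ]·δ[t+1−τ] + d_u[t] (the series converging absolutely); δ[t] = d_x[t−1] + B·d_u[t−1] + d_δ[t]; and sup_{t≤0} ‖x[t]‖ < ∞. Then x, u, and δ are all bounded signals. That is, the controller u[t] = Σ_{τ≥1} Φ_u[τ]·δ[t+1−τ] with δ[t]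 = x[t] − A·x[t−1] − B·u[t−1] is internally stabilizing for the open-loop stable plant. -/
/-- The ℓ²→ℓ² operator norm of a real matrix, i.e. the norm of the associated
linear map between Euclidean spaces. -/
noncomputable def l2OpNorm {m n : ℕ} (M : Matrix (Fin m) (Fin n) ℝ) : ℝ :=
  ‖(Matrix.toEuclideanLin M).toContinuousLinearMap‖

open Filter

/-- In a complex Banach algebra, an element whose spectrum lies in the open unit disc has
summable powers. -/
theorem summable_norm_pow_of_forall_spectrum_norm_lt_one {R : Type*} [NormedRing R]
    [NormedAlgebra ℂ R] [CompleteSpace R] (a : R) (ha : ∀ μ ∈ spectrum ℂ a, ‖μ‖ < 1) :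
    Summable fun n : ℕ => ‖a ^ n‖ := by
  rcases subsingleton_or_nontrivial R with hR | hR
  · have h_zero : ∀ n : ℕ, ‖a ^ n‖ = 0 := fun n => by
      rw [Subsingleton.elim (a ^ n) 0, norm_zero]
    simpa only [h_zero] using (summable_zero : Summable fun _ : ℕ => (0 : ℝ))
  have h_rad : spectralRadius ℂ a < (1 : NNReal) :=
    spectrum.spectralRadius_lt_of_forall_lt a fun μ hμ => by
      simpa [← NNReal.coe_lt_coe] using ha μ hμ
  obtain ⟨r, hr_rad, hr_one⟩ := ENNReal.lt_iff_exists_nnreal_btwn.mp h_rad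
  have hr_one : r < 1 := by exact_mod_cast hr_one
  have h_ev : ∀ᶠ n : ℕ in atTop, ‖a ^ n‖ ≤ (r : ℝ) ^ n := by
    filter_upwards [(spectrum.pow_nnnorm_pow_one_div_tendsto_nhds_spectralRadius a).eventually
      (eventually_lt_nhds hr_rad), eventually_gt_atTop 0] with n hn hn_pos
    have h_pos : (0 : ℝ) < n := by exact_mod_cast hn_pos
    have h_le := ENNReal.rpow_le_rpow hn.le h_pos.le
    rw [← ENNReal.rpow_mul, one_div_mul_cancel h_pos.ne', ENNReal.rpow_one,
      ENNReal.rpow_natCast] at h_le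
    exact_mod_cast h_le
  have h_geom : Summable fun n : ℕ => (r : ℝ) ^ n :=
    summable_geometric_of_lt_one r.coe_nonneg (by exact_mod_cast hr_one)
  exact h_geom.of_norm_bounded_eventually_nat (by simpa using h_ev)

/-- The coordinatewise inclusion of real Euclidean space into complex Euclidean space. -/
noncomputable def euclideanComplexify {n : ℕ} (v : EuclideanSpace ℝ (Fin n)) :
    EuclideanSpace ℂ (Fin n) :=
  WithLp.toLp 2 fun i => (v i : ℂ)

theorem norm_euclideanComplexify {n : ℕ} (v : EuclideanSpace ℝ (Fin n)) :
    ‖euclideanComplexify v‖ = ‖v‖ := by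
  simp [EuclideanSpace.norm_eq, euclideanComplexify]

theorem euclideanComplexify_toEuclideanLin {n : ℕ} (A : Matrix (Fin n) (Fin n) ℝ)
    (v : EuclideanSpace ℝ (Fin n)) :
    euclideanComplexify (Matrix.toEuclideanLin A v) =
      Matrix.toEuclideanCLM (𝕜 := ℂ) (A.map (algebraMap ℝ ℂ)) (euclideanComplexify v) := by
  ext i
  simp [euclideanComplexify, Matrix.mulVec, dotProduct]

theorem euclideanComplexify_toEuclideanLin_pow {n : ℕ} (A : Matrix (Fin n) (Fin n) ℝ) (k : ℕ)
    (v : EuclideanSpace ℝ (Fin n)) :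
    euclideanComplexify ((Matrix.toEuclideanLin A ^ k) v) =
      (Matrix.toEuclideanCLM (𝕜 := ℂ) (A.map (algebraMap ℝ ℂ)) ^ k) (euclideanComplexify v) := by
  induction k with
  | zero => simp
  | succ k ih =>
    rw [pow_succ', pow_succ', Module.End.mul_apply, mul_apply_eq_comp,
      euclideanComplexify_toEuclideanLin, ih]

/-- The powers of a Schur stable real matrix are dominated by a summable sequence. -/
theorem exists_summable_bound_toEuclideanLin_pow {n : ℕ} (A : Matrix (Fin n) (Fin n) ℝ)
    (hA : ∀ μ ∈ spectrum ℂ (A.map (algebraMap ℝ ℂ)), ‖μ‖ < 1) :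
    ∃ g : ℕ → ℝ, Summable g ∧ (∀ k, 0 ≤ g k) ∧
      ∀ k v, ‖(Matrix.toEuclideanLin A ^ k) v‖ ≤ g k * ‖v‖ := by
  refine ⟨fun k => ‖Matrix.toEuclideanCLM (𝕜 := ℂ) (A.map (algebraMap ℝ ℂ)) ^ k‖,
    summable_norm_pow_of_forall_spectrum_norm_lt_one _ ?_, fun k => norm_nonneg _,
    fun k v => ?_⟩
  · rwa [AlgEquiv.spectrum_eq]
  · rw [← norm_euclideanComplexify, ← norm_euclideanComplexify v,
      euclideanComplexify_toEuclideanLin_pow]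
    exact ContinuousLinearMap.le_opNorm _ _

theorem linear_recurrence_eq_sum {R E : Type*} [Semiring R] [AddCommMonoid E] [Module R E]
    (L : E →ₗ[R] E) (x w : ℕ → E) (hx : ∀ n, x (n + 1) = L (x n) + w n) (n : ℕ) :
    x n = (L ^ n) (x 0) + ∑ k ∈ Finset.range n, (L ^ k) (w (n - 1 - k)) := by
  induction n with
  | zero => simp
  | succ n ih =>
    rw [hx, Finset.sum_range_succ']
    conv_lhs => rw [ih]
    rw [map_add, map_sum, add_assoc, ← Module.End.mul_apply, ← pow_succ']
    congr 2
    refine Finset.sum_congr rfl fun k _ => ?_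
    rw [← Module.End.mul_apply, ← pow_succ', Nat.add_sub_cancel, Nat.sub_add_eq,
      Nat.sub_right_comm]

/-- Bounded-input bounded-state stability of a linear recurrence whose powers are dominated by a
summable sequence. -/
theorem norm_linear_recurrence_le {𝕜 E : Type*} [NormedField 𝕜] [SeminormedAddCommGroup E]
    [NormedSpace 𝕜 E] (L : E →ₗ[𝕜] E) {g : ℕ → ℝ} (hg : Summable g) (hg_nonneg : ∀ k, 0 ≤ g k)
    (hL : ∀ k v, ‖(L ^ k) v‖ ≤ g k * ‖v‖) {x w : ℕ → E}
    (hx : ∀ n, x (n + 1) = L (x n) + w n) {c : ℝ} (hw : ∀ n, ‖w n‖ ≤ c) (n : ℕ) :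
    ‖x n‖ ≤ (∑' k, g k) * ‖x 0‖ + (∑' k, g k) * c := by
  have hc : 0 ≤ c := (norm_nonneg _).trans (hw 0)
  rw [linear_recurrence_eq_sum L x w hx n]
  refine (norm_add_le _ _).trans (add_le_add ?_ ?_)
  · refine (hL n _).trans ?_
    gcongr
    exact hg.le_tsum n fun k _ => hg_nonneg k
  · calc ‖∑ k ∈ Finset.range n, (L ^ k) (w (n - 1 - k))‖
        ≤ ∑ k ∈ Finset.range n, g k * c := by
          refine norm_sum_le_of_le _ fun k _ => (hL k _).trans ?_
          exact mul_le_mul_of_nonneg_left (hw _) (hg_nonneg k)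
      _ = (∑ k ∈ Finset.range n, g k) * c := by rw [Finset.sum_mul]
      _ ≤ (∑' k, g k) * c := by
          gcongr
          exact hg.sum_le_tsum _ fun k _ => hg_nonneg k

theorem norm_toEuclideanLin_le {m n : ℕ} (M : Matrix (Fin m) (Fin n) ℝ)
    (v : EuclideanSpace ℝ (Fin n)) : ‖Matrix.toEuclideanLin M v‖ ≤ l2OpNorm M * ‖v‖ :=
  (Matrix.toEuclideanLin M).toContinuousLinearMap.le_opNorm v

theorem l2OpNorm_nonneg {m n : ℕ} (M : Matrix (Fin m) (Fin n) ℝ) : 0 ≤ l2OpNorm M :=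
  norm_nonneg _

/-- internal stability of the simplified SLS controller, time domain:
with `A` Schur stable, `Σ_{τ≥1} ‖Φu[τ]‖ < ∞`, bounded injected signals
`d_x, d_u, d_δ`, closed-loop equations
`x[t+1] = A x[t] + B u[t] + d_x[t]`,
`u[t] = Σ_{τ≥1} Φu[τ] δ[t+1-τ] + d_u[t]` (absolutely convergent), and
`δ[t] = d_x[t-1] + B d_u[t-1] + d_δ[t]`, together with `sup_{t≤0} ‖x[t]‖ < ∞`,
the signals `x`, `u`, `δ` are all bounded.
Here `Φu (τ+1)` plays the role of the spectral component `Φu[τ+1]`, `τ+1 ≥ 1`. -/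
theorem sls_controller_internally_stabilizing (Nx Nu : ℕ)
    (A : Matrix (Fin Nx) (Fin Nx) ℝ) (B : Matrix (Fin Nx) (Fin Nu) ℝ)
    (hschur : ∀ μ ∈ spectrum ℂ (A.map (algebraMap ℝ ℂ)), ‖μ‖ < 1)
    (Φu : ℕ → Matrix (Fin Nu) (Fin Nx) ℝ)
    (hΦu : Summable fun τ : ℕ => l2OpNorm (Φu (τ + 1)))
    (dx dδ : ℤ → EuclideanSpace ℝ (Fin Nx)) (du : ℤ → EuclideanSpace ℝ (Fin Nu))
    (hdx : ∃ c : ℝ, ∀ t : ℤ, ‖dx t‖ ≤ c)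
    (hdu : ∃ c : ℝ, ∀ t : ℤ, ‖du t‖ ≤ c)
    (hdδ : ∃ c : ℝ, ∀ t : ℤ, ‖dδ t‖ ≤ c)
    (x δ : ℤ → EuclideanSpace ℝ (Fin Nx)) (u : ℤ → EuclideanSpace ℝ (Fin Nu))
    (hplant : ∀ t : ℤ, x (t + 1) =
      (Matrix.toEuclideanLin A) (x t) + (Matrix.toEuclideanLin B) (u t) + dx t)
    (habs : ∀ t : ℤ, Summable fun τ : ℕ =>
      ‖(Matrix.toEuclideanLin (Φu (τ + 1))) (δ (t - τ))‖)
    (hu : ∀ t : ℤ, u t =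
      (∑' τ : ℕ, (Matrix.toEuclideanLin (Φu (τ + 1))) (δ (t - τ))) + du t)
    (hδ : ∀ t : ℤ, δ t = dx (t - 1) + (Matrix.toEuclideanLin B) (du (t - 1)) + dδ t)
    (hpast : ∃ c : ℝ, ∀ t : ℤ, t ≤ 0 → ‖x t‖ ≤ c) :
    (∃ c : ℝ, ∀ t : ℤ, ‖x t‖ ≤ c) ∧
    (∃ c : ℝ, ∀ t : ℤ, ‖u t‖ ≤ c) ∧
    (∃ c : ℝ, ∀ t : ℤ, ‖δ t‖ ≤ c) := by
  obtain ⟨cx, hcx⟩ := hdx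
  obtain ⟨cu, hcu⟩ := hdu
  obtain ⟨cδ, hcδ⟩ := hdδ
  obtain ⟨cp, hcp⟩ := hpast
  have toEuclideanLin_B_le : ∀ {c : ℝ} {v : EuclideanSpace ℝ (Fin Nu)}, ‖v‖ ≤ c →
      ‖Matrix.toEuclideanLin B v‖ ≤ l2OpNorm B * c := fun hv =>
    (norm_toEuclideanLin_le B _).trans (mul_le_mul_of_nonneg_left hv (l2OpNorm_nonneg B))
  obtain ⟨D, hD⟩ : ∃ c : ℝ, ∀ t : ℤ, ‖δ t‖ ≤ c := by
    refine ⟨cx + l2OpNorm B * cu + cδ, fun t => ?_⟩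
    rw [hδ t]
    exact norm_add₃_le.trans
      (add_le_add_three (hcx _) (toEuclideanLin_B_le (hcu _)) (hcδ t))
  obtain ⟨U, hU⟩ : ∃ c : ℝ, ∀ t : ℤ, ‖u t‖ ≤ c := by
    refine ⟨(∑' τ : ℕ, l2OpNorm (Φu (τ + 1))) * D + cu, fun t => ?_⟩
    rw [hu t]
    refine (norm_add_le _ _).trans (add_le_add ?_ (hcu t))
    exact tsum_of_norm_bounded (hΦu.hasSum.mul_right D) fun τ =>
      (norm_toEuclideanLin_le _ _).trans
        (mul_le_mul_of_nonneg_left (hD _) (l2OpNorm_nonneg _))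
  refine ⟨?_, ⟨U, hU⟩, ⟨D, hD⟩⟩
  obtain ⟨g, hg, hg_nonneg, hgA⟩ := exists_summable_bound_toEuclideanLin_pow A hschur
  have h_future := norm_linear_recurrence_le (Matrix.toEuclideanLin A) hg hg_nonneg hgA
    (x := fun n : ℕ => x n) (w := fun n : ℕ => Matrix.toEuclideanLin B (u n) + dx n)
    (fun n => by push_cast; rw [hplant, add_assoc])
    (fun n => norm_add_le_of_le (toEuclideanLin_B_le (hU n)) (hcx n))
  refine ⟨max cp ((∑' k, g k) * ‖x (0 : ℕ)‖ + (∑' k, g k) * (l2OpNorm B * U + cx)),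
    fun t => ?_⟩
  rcases le_total t 0 with ht | ht
  · exact (hcp t ht).trans (le_max_left _ _)
  · lift t to ℕ using ht
    exact (h_future t).trans (le_max_right _ _)
end
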